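/- (Proposition 6.3) Let Σ, θ, η > 0 and let τ : ℝ² → ℝ satisfy: (τ1) for each t ∈ ℝ the map y ↦ τ(y,t) is differentiable and its derivative y ↦ ∂_yτ(y,t) is 2Σ-Lipschitz; (τ2) θ·|t₂ − t₁| ≤ |τ(y,t₂) − τ(y,t₁)| ≤ θ⁻¹·|t₂ − t₁| for all y, t₁, t₂ ∈ ℝ; (τ3) |∂_yτ(y,t₂) − ∂_yτ(y,t₁)| ≤ η·|t₂ − t₁|^{1/2} for all y, t₁, t₂ ∈ ℝ. Define Ψ : ℝ² → ℍ by Ψ(y,t) = (0, y, τ(y,t)) · (∂_yτ(y,t), 0, 0) and set Γ = Ψ(ℝ²). Then there exist constants L ≥ 1 and C ≥ 1, depending only on η, Σ and θ, such that: (a) Π restricted to Γ is a bijection onto 𝕎 and ‖Π_𝕃(q⁻¹·p)‖ ≤ L·‖Π(q⁻¹·p)‖ for all p, q ∈ Γ (so Γ is an intrinsic L-Lipschitz graph over 𝕎); and (b) Ψ is C-bilipschitz from (ℝ², d_par) into (ℍ, d), i.e. C⁻¹·d_par(w,w') ≤ d(Ψ(w), Ψ(w')) ≤ C·d_par(w,w')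 for all w, w' ∈ ℝ². -/

import Mathlib

open scoped ENNReal

namespace HeisRug

/-- The first Heisenberg group, as a set: ℝ³. -/
abbrev Hei : Type := ℝ × ℝ × ℝ

/-- Heisenberg group multiplication. -/
noncomputable def Hmul (p q : Hei) : Hei :=
  (p.1 + q.1, p.2.1 + q.2.1, p.2.2 + q.2.2 + (p.1 * q.2.1 - q.1 * p.2.1) / 2)

/-- Heisenberg group inverse. -/
def Hinv (p : Hei) : Hei := (-p.1, -p.2.1, -p.2.2)

/-- Homogeneous norm on the Heisenberg group. -/
noncomputable def Hnorm (p : Hei) : ℝ :=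
  max (Real.sqrt (p.1 ^ 2 + p.2.1 ^ 2)) (Real.sqrt |p.2.2|)

/-- Left-invariant metric `d(p,q) = ‖q⁻¹·p‖` on the Heisenberg group. -/
noncomputable def dH (p q : Hei) : ℝ := Hnorm (Hmul (Hinv q) p)

/-- Parabolic metric on the parabolic plane 𝕎 = ℝ². -/
noncomputable def dPar (w w' : ℝ × ℝ) : ℝ :=
  max |w.1 - w'.1| (Real.sqrt |w.2 - w'.2|)

/-- Distance from a point to a set in (ℍ, d). -/
noncomputable def distH (p : Hei) (E : Set Hei) : ℝ := sInf ((dH p) '' E)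

/-- Closed δ-neighbourhood of a set in ℍ. -/
def NH (E : Set Hei) (δ : ℝ) : Set Hei := {p | distH p E ≤ δ}

/-- Closed ball in (ℍ, d). -/
def BH (p : Hei) (r : ℝ) : Set Hei := {q | dH q p ≤ r}

/-- Closed parabolic ball in 𝕎. -/
def BPar (w : ℝ × ℝ) (r : ℝ) : Set (ℝ × ℝ) := {v | dPar v w ≤ r}

/-- Diameter (in ℝ≥0∞) with respect to the Heisenberg metric. -/
noncomputable def ediamH (E : Set Hei) : ℝ≥0∞ :=
  ⨆ p ∈ E, ⨆ q ∈ E, ENNReal.ofReal (dH p q)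

/-- The 3-dimensional Hausdorff measure on (ℍ, d), as a set function. -/
noncomputable def H3 (E : Set Hei) : ℝ≥0∞ :=
  ⨆ (δ : ℝ≥0∞) (_ : 0 < δ),
    ⨅ (U : ℕ → Set Hei) (_ : E ⊆ ⋃ n, U n) (_ : ∀ n, ediamH (U n) ≤ δ),
      ∑' n, ediamH (U n) ^ 3

/-- Isometric embedding of the parabolic plane onto the subgroup 𝕎 ⊂ ℍ. -/
def embedW (w : ℝ × ℝ) : Hei := (0, w.1, w.2)

/-- The vertical subgroup 𝕎 = {(0,y,t)} of ℍ. -/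
def Wsub : Set Hei := {p | p.1 = 0}

/-- Rotation by angle θ about the t-axis. -/
noncomputable def Rrot (θ : ℝ) (p : Hei) : Hei :=
  (p.1 * Real.cos θ - p.2.1 * Real.sin θ, p.1 * Real.sin θ + p.2.1 * Real.cos θ, p.2.2)

/-- Vertical projection Π : ℍ → 𝕎. -/
noncomputable def Piproj (p : Hei) : Hei := (0, p.2.1, p.2.2 + p.1 * p.2.1 / 2)

/-- Horizontal projection Π_𝕃 : ℍ → 𝕃. -/
def PiL (p : Hei) : Hei := (p.1, 0, 0)

/-- Vertical projection Π_θ = R_θ ∘ Π ∘ R_θ⁻¹ onto 𝕎_θ. -/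
noncomputable def PiTheta (θ : ℝ) (p : Hei) : Hei := Rrot θ (Piproj (Rrot (-θ) p))

/-- `f : 𝕎 → ℍ` is M-bilipschitz. -/
def IsBilipschitz (M : ℝ) (f : ℝ × ℝ → Hei) : Prop :=
  ∀ w w' : ℝ × ℝ,
    M⁻¹ * dPar w w' ≤ dH (f w) (f w') ∧ dH (f w) (f w') ≤ M * dPar w w'

/-- A Rickman rug: the image of the parabolic plane under a bilipschitz map. -/
def IsRickmanRug (E : Set Hei) : Prop :=
  ∃ M : ℝ, 1 ≤ M ∧ ∃ f : ℝ × ℝ → Hei, IsBilipschitz M f ∧ E = Set.range f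

/-- A horizontal line in ℍ. -/
def IsHorizontalLine (L : Set Hei) : Prop :=
  ∃ p : Hei, ∃ v : ℝ × ℝ, v ≠ 0 ∧
    L = {q | ∃ s : ℝ, q = Hmul p (s * v.1, s * v.2, 0)}

/-- The vertical plane spanned by a horizontal line. -/
def VSpan (L : Set Hei) : Set Hei := {q | ∃ p ∈ L, ∃ t : ℝ, q = Hmul p (0, 0, t)}

/-- Vertical planes in ℍ. -/
def IsVerticalPlane (V : Set Hei) : Prop :=
  ∃ L : Set Hei, IsHorizontalLine L ∧ V = VSpan L

/-- The horizontal line {(a·y + b, y, b·y/2 + c) : y ∈ ℝ} (of slope |a|). -/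
def hline (a b c : ℝ) : Set Hei :=
  {p | ∃ y : ℝ, p = (a * y + b, y, b * y / 2 + c)}

/-- A horizontal line of (finite) slope at most Σ. -/
def HLineSlopeLe (S : ℝ) (L : Set Hei) : Prop :=
  ∃ a b c : ℝ, |a| ≤ S ∧ L = hline a b c

/-- A vertical plane of (finite) slope at most Σ (relative to 𝕎). -/
def VPlaneSlopeLe (S : ℝ) (V : Set Hei) : Prop :=
  ∃ a b : ℝ, |a| ≤ S ∧ V = {p : Hei | p.1 = a * p.2.1 + b}

/-- A vertical plane whose slope relative to 𝕎_θ equals 0. -/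
def SlopeZeroRel (θ : ℝ) (V : Set Hei) : Prop :=
  ∃ b : ℝ, Rrot (-θ) '' V = {p : Hei | p.1 = b}

/-- The horizontal line ℝ × {t} in the parabolic plane. -/
def lineW (t : ℝ) : Set (ℝ × ℝ) := {w | w.2 = t}

/-- Ruler coefficient ρ_f(B_par(w,r)). -/
noncomputable def rulerCoef (f : ℝ × ℝ → Hei) (w : ℝ × ℝ) (r : ℝ) : ℝ :=
  sInf {ρ : ℝ | 0 < ρ ∧ ∀ t : ℝ, ∃ L : Set Hei, IsHorizontalLine L ∧
    f '' (lineW t ∩ BPar w r) ⊆ NH L (ρ * r)}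

/-- β_f(𝕍; B_par(w,r)): approximation number relative to the vertical plane 𝕍. -/
noncomputable def betaV (f : ℝ × ℝ → Hei) (V : Set Hei) (w : ℝ × ℝ) (r : ℝ) : ℝ :=
  sInf {ε : ℝ | 0 < ε ∧ ∀ t : ℝ, ∃ L : Set Hei, IsHorizontalLine L ∧ L ⊆ V ∧
    f '' (lineW t ∩ BPar w r) ⊆ NH L (ε * r)}

/-- The strong vertical β-number β_f(B_par(w,r)) = inf_𝕍 β_f(𝕍; B_par(w,r)). -/
noncomputable def beta (f : ℝ × ℝ → Hei) (w : ℝ × ℝ) (r : ℝ) : ℝ :=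
  sInf {b : ℝ | ∃ V : Set Hei, IsVerticalPlane V ∧ b = betaV f V w r}

/-- Index set for dyadic parabolic rectangles: (n, k, l). -/
abbrev Idx : Type := ℤ × ℤ × ℤ

/-- Side length ℓ(Q) = 2⁻ⁿ of the dyadic parabolic rectangle with index (n,k,l). -/
noncomputable def sideLen (i : Idx) : ℝ := (2 : ℝ) ^ (-i.1)

/-- The dyadic parabolic rectangle [k·2⁻ⁿ, (k+1)·2⁻ⁿ) × [l·4⁻ⁿ, (l+1)·4⁻ⁿ). -/
noncomputable def rect (i : Idx) : Set (ℝ × ℝ) :=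
  Set.Ico ((i.2.1 : ℝ) * (2 : ℝ) ^ (-i.1)) (((i.2.1 : ℝ) + 1) * (2 : ℝ) ^ (-i.1)) ×ˢ
  Set.Ico ((i.2.2 : ℝ) * (4 : ℝ) ^ (-i.1)) (((i.2.2 : ℝ) + 1) * (4 : ℝ) ^ (-i.1))

/-- The centre c_Q of a dyadic parabolic rectangle. -/
noncomputable def center (i : Idx) : ℝ × ℝ :=
  (((i.2.1 : ℝ) + 1 / 2) * (2 : ℝ) ^ (-i.1), ((i.2.2 : ℝ) + 1 / 2) * (4 : ℝ) ^ (-i.1))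

/-- λQ := B_par(c_Q, λ·ℓ(Q)). -/
noncomputable def dilate (lam : ℝ) (i : Idx) : Set (ℝ × ℝ) := BPar (center i) (lam * sideLen i)

/-- j indexes a 𝒟-child of the rectangle indexed by i. -/
def IsChild (j i : Idx) : Prop := j.1 = i.1 + 1 ∧ rect j ⊆ rect i

/-- T ⊆ 𝒟 is a tree with root rt. -/
def IsTreeWithRoot (T : Set Idx) (rt : Idx) : Prop :=
  rt ∈ T ∧ (∀ i ∈ T, rect i ⊆ rect rt) ∧
  (∀ i j k : Idx, i ∈ T → k ∈ T → rect i ⊆ rect j → rect j ⊆ rect k → j ∈ T) ∧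
  (∀ i ∈ T, (∀ j : Idx, IsChild j i → j ∈ T) ∨ (∀ j : Idx, IsChild j i → j ∉ T))

/-- T ⊆ 𝒟 is a tree. -/
def IsTree (T : Set Idx) : Prop := ∃ rt : Idx, IsTreeWithRoot T rt

/-- Q is (ε,H,Σ)-vertical for f : there is a vertical plane 𝕍_Q of slope ≤ Σ with
β_f(𝕍_Q; HQ) < ε/H. -/
def IsVerticalRect (f : ℝ × ℝ → Hei) (ε Hc S : ℝ) (i : Idx) : Prop :=
  ∃ V : Set Hei, VPlaneSlopeLe S V ∧ betaV f V (center i) (Hc * sideLen i) < ε / Hc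

/-- Q is (δ,C)-ruled for f. -/
def IsRuled (f : ℝ × ℝ → Hei) (δ C : ℝ) (i : Idx) : Prop :=
  ∀ t : ℝ, ∃ L : Set Hei, IsHorizontalLine L ∧
    f '' (lineW t ∩ dilate C i) ⊆ NH L (δ * sideLen i)

/-- Q is (δ,C,Σ)-ruled for f. -/
def IsRuledSlope (f : ℝ × ℝ → Hei) (δ C S : ℝ) (i : Idx) : Prop :=
  IsRuled f δ C i ∧ ∃ t : ℝ, (lineW t ∩ rect i).Nonempty ∧
    ∃ L : Set Hei, HLineSlopeLe S L ∧
      f '' (lineW t ∩ dilate C i) ⊆ NH L (δ * sideLen i)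

/-- Γ is an intrinsic L-Lipschitz graph over 𝕎. -/
def IsIntrinsicLipGraph (L : ℝ) (Γ : Set Hei) : Prop :=
  Set.BijOn Piproj Γ Wsub ∧
  ∀ p ∈ Γ, ∀ q ∈ Γ,
    Hnorm (PiL (Hmul (Hinv q) p)) ≤ L * Hnorm (Piproj (Hmul (Hinv q) p))

/-- Γ is an intrinsic L-Lipschitz graph over 𝕎_θ. -/
def IsIntrinsicLipGraphOver (θ L : ℝ) (Γ : Set Hei) : Prop :=
  IsIntrinsicLipGraph L (Rrot (-θ) '' Γ)

/-- An intrinsic bilipschitz graph: an intrinsic Lipschitz graph over some vertical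
subgroup which is also a Rickman rug. -/
def IsIntrinsicBilipGraph (Γ : Set Hei) : Prop :=
  (∃ θ ∈ Set.Ico (-(Real.pi / 2)) (Real.pi / 2), ∃ L : ℝ, 1 ≤ L ∧
    IsIntrinsicLipGraphOver θ L Γ) ∧ IsRickmanRug Γ

/-- (M,ε)-quasi-isometric embedding between sets with distance functions. -/
def IsQIEOn {X Y : Type*} (dX : X → X → ℝ) (dY : Y → Y → ℝ) (A : Set X)
    (M ε : ℝ) (F : X → Y) : Prop :=
  ∀ x ∈ A, ∀ x' ∈ A,
    M⁻¹ * dX x x' - ε ≤ dY (F x) (F x') ∧ dY (F x) (F x') ≤ M * dX x x' + ε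

/-- d is a metric on ℝ. -/
def IsMetricOn (d : ℝ → ℝ → ℝ) : Prop :=
  (∀ x y, d x y = d y x) ∧ (∀ x y, d x y = 0 ↔ x = y) ∧
  (∀ x y z, d x z ≤ d x y + d y z)

/-- d is an orderly metric on ℝ. -/
def Orderly (d : ℝ → ℝ → ℝ) : Prop :=
  IsMetricOn d ∧
  (∀ x : ℝ, ∀ ε > (0 : ℝ), ∃ δ > (0 : ℝ), ∀ y : ℝ, |x - y| < δ → d x y < ε) ∧
  (∀ x y z : ℝ, x ≤ y → y ≤ z → max (d x y) (d y z) ≤ d x z)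

/-- F : I×J → 𝕎 is a horizontal (M,ε)-QIE. -/
def IsHorizQIE (M ε : ℝ) (I J : Set ℝ) (F : ℝ × ℝ → ℝ × ℝ) : Prop :=
  IsQIEOn dPar dPar (I ×ˢ J) M ε F ∧
  (∀ t ∈ J, ∃ c : ℝ, ∀ y ∈ I, (F (y, t)).2 = c)



lemma surj_mono (f : ℝ → ℝ) (θ : ℝ) (hθ : 0 < θ) (hc : Continuous f) (hm : StrictMono f)
    (hl : ∀ a b, θ * |b - a| ≤ |f b - f a|) (c : ℝ) : ∃ t, f t = c := by
  set R := |c - f 0| / θ with hR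
  have hR0 : 0 ≤ R := by positivity
  have hRθ : θ * R = |c - f 0| := by rw [hR]; field_simp
  have h1 := hl 0 R
  have h2 := hl 0 (-R)
  rw [sub_zero, abs_of_nonneg hR0, abs_of_nonneg (sub_nonneg.2 (hm.monotone hR0)), hRθ] at h1
  rw [sub_zero, abs_neg, abs_of_nonneg hR0,
    abs_of_nonpos (sub_nonpos.2 (hm.monotone (by linarith : -R ≤ 0))), hRθ] at h2
  have h3 := le_abs_self (c - f 0)
  have h4 := neg_abs_le (c - f 0)
  obtain ⟨t, -, ht⟩ := intermediate_value_Icc (by linarith : -R ≤ R) hc.continuousOn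
    (show c ∈ Set.Icc (f (-R)) (f R) from ⟨by linarith, by linarith⟩)
  exact ⟨t, ht⟩

lemma surj_aux (f : ℝ → ℝ) (θ : ℝ) (hθ : 0 < θ)
    (hl : ∀ a b, θ * |b - a| ≤ |f b - f a| ∧ |f b - f a| ≤ θ⁻¹ * |b - a|) (c : ℝ) :
    ∃ t, f t = c := by
  have hc : Continuous f := by
    have : LipschitzWith (Real.toNNReal θ⁻¹) f := by
      apply LipschitzWith.of_dist_le_mul
      intro a b
      rw [Real.dist_eq, Real.dist_eq, Real.coe_toNNReal _ (by positivity)]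
      exact (hl b a).2
    exact this.continuous
  have hi : Function.Injective f := by
    intro a b hab
    have h := (hl a b).1
    rw [hab, sub_self, abs_zero] at h
    have : |b - a| ≤ 0 := by
      by_contra hn
      push Not at hn
      have := mul_pos hθ hn
      linarith
    have := abs_nonpos_iff.1 this
    linarith
  rcases hc.strictMono_of_inj hi with hm | hm
  · exact surj_mono f θ hθ hc hm (fun a b => (hl a b).1) c
  · obtain ⟨t, ht⟩ := surj_mono (fun x => - f x) θ hθ hc.neg
      (fun a b hab => neg_lt_neg (hm hab))
      (fun a b => by
        have := (hl a b).1
        rwa [show - f b - - f a = -(f b - f a) by ring, abs_neg]) (-c)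
    exact ⟨t, by linarith⟩

lemma taylor_aux (f f' : ℝ → ℝ) (S : ℝ) (hS : 0 < S) (hd : ∀ y, HasDerivAt f (f' y) y)
    (hl : ∀ a b, |f' a - f' b| ≤ 2 * S * |a - b|) (y₀ y : ℝ) :
    |f y - f y₀ - f' y₀ * (y - y₀)| ≤ 2 * S * |y - y₀| ^ 2 := by
  have h := Convex.norm_image_sub_le_of_norm_hasDerivWithin_le (s := Set.uIcc y₀ y)
    (f := fun z => f z - f' y₀ * z) (f' := fun z => f' z - f' y₀) (C := 2 * S * |y - y₀|)
    (x := y₀) (y := y)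
    (fun z _ => by
      have := ((hd z).sub ((hasDerivAt_id z).const_mul (f' y₀))).hasDerivWithinAt
        (s := Set.uIcc y₀ y)
      simp only [mul_one, id] at this
      exact this)
    (fun z hz => by
      rw [Real.norm_eq_abs]
      refine (hl z y₀).trans ?_
      have := Set.abs_sub_left_of_mem_uIcc hz
      gcongr)
    (convex_uIcc _ _) Set.left_mem_uIcc Set.right_mem_uIcc
  rw [Real.norm_eq_abs, Real.norm_eq_abs] at h
  calc _ = |f y - f' y₀ * y - (f y₀ - f' y₀ * y₀)| := by congr 1; ring
    _ ≤ _ := h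
    _ = _ := by ring

lemma sqrt_sq_add_le (x y : ℝ) : Real.sqrt (x ^ 2 + y ^ 2) ≤ |x| + |y| := by
  rw [Real.sqrt_le_left (by positivity)]
  have := mul_nonneg (abs_nonneg x) (abs_nonneg y)
  nlinarith [sq_abs x, sq_abs y]

lemma Hnorm_proj (h D : ℝ) : Hnorm (0, h, D) = max |h| (Real.sqrt |D|) := by
  simp [Hnorm, Real.sqrt_sq_eq_abs]

/-- Estimates in real coordinates. -/
lemma sqrt_le_of {x K M : ℝ} (hK : 0 ≤ K) (hM : 0 ≤ M) (h : x ≤ K * M ^ 2) :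
    Real.sqrt x ≤ Real.sqrt K * M := by
  rw [← Real.sqrt_sq hM, ← Real.sqrt_mul hK]
  exact Real.sqrt_le_sqrt h

/-- **Proposition 6.3.** The graph map Ψ built from τ parametrizes an intrinsic
Lipschitz graph over 𝕎 and is bilipschitz from (𝕎, d_par) into (ℍ, d). -/
theorem graph_map_is_intrinsic_Lipschitz_and_bilipschitz
    (S θ η : ℝ) (hS : 0 < S) (hθ : 0 < θ) (hη : 0 < η) :
    ∃ L : ℝ, 1 ≤ L ∧ ∃ C : ℝ, 1 ≤ C ∧
      ∀ τ τ' : ℝ × ℝ → ℝ,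
        (∀ y t : ℝ, HasDerivAt (fun z : ℝ => τ (z, t)) (τ' (y, t)) y) →
        (∀ t y₁ y₂ : ℝ, |τ' (y₁, t) - τ' (y₂, t)| ≤ 2 * S * |y₁ - y₂|) →
        (∀ y t₁ t₂ : ℝ, θ * |t₂ - t₁| ≤ |τ (y, t₂) - τ (y, t₁)| ∧
          |τ (y, t₂) - τ (y, t₁)| ≤ θ⁻¹ * |t₂ - t₁|) →
        (∀ y t₁ t₂ : ℝ, |τ' (y, t₂) - τ' (y, t₁)| ≤ η * Real.sqrt |t₂ - t₁|) →
        IsIntrinsicLipGraph L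
          (Set.range fun w : ℝ × ℝ => Hmul (0, w.1, τ w) (τ' w, 0, 0)) ∧
        ∀ w w' : ℝ × ℝ,
          C⁻¹ * dPar w w' ≤
            dH (Hmul (0, w.1, τ w) (τ' w, 0, 0)) (Hmul (0, w'.1, τ w') (τ' w', 0, 0)) ∧
          dH (Hmul (0, w.1, τ w) (τ' w, 0, 0)) (Hmul (0, w'.1, τ w') (τ' w', 0, 0))
            ≤ C * dPar w w' := by
  set K := Real.sqrt ((1 + 2 * S) / θ) with hK
  have hK0 : 0 ≤ K := Real.sqrt_nonneg _
  set C₁ := Real.sqrt (θ⁻¹ + 2 * S + (S + η / 2)) with hC₁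
  have hC₁0 : 0 ≤ C₁ := Real.sqrt_nonneg _
  refine ⟨1 + 2 * S + η * K, by nlinarith [mul_nonneg hη.le hK0],
    2 * (1 + K) + (1 + 2 * S + η) + C₁, by linarith, ?_⟩
  set C := 2 * (1 + K) + (1 + 2 * S + η) + C₁ with hC
  intro τ τ' hd hl hb hh
  have hmul : ∀ w : ℝ × ℝ, Hmul (0, w.1, τ w) (τ' w, 0, 0)
      = (τ' w, w.1, τ w - τ' w * w.1 / 2) := by
    intro w
    simp only [Hmul, Prod.mk.injEq]
    refine ⟨by ring, by ring, by ring⟩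
  have hprod : ∀ w v : ℝ × ℝ, Hmul (Hinv (τ' v, v.1, τ v - τ' v * v.1 / 2))
      (τ' w, w.1, τ w - τ' w * w.1 / 2) = (τ' w - τ' v, w.1 - v.1,
        (τ w - τ v - τ' v * (w.1 - v.1)) - (τ' w - τ' v) * (w.1 - v.1) / 2) := by
    intro w v
    simp only [Hmul, Hinv, Prod.mk.injEq]
    refine ⟨by ring, by ring, by ring⟩
  have hproj : ∀ w v : ℝ × ℝ, Piproj (Hmul (Hinv (τ' v, v.1, τ v - τ' v * v.1 / 2))
      (τ' w, w.1, τ w - τ' w * w.1 / 2)) = (0, w.1 - v.1,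
        (τ w - τ v - τ' v * (w.1 - v.1))) := by
    intro w v
    rw [hprod]
    simp only [Piproj, Prod.mk.injEq]
    refine ⟨trivial, trivial, by ring⟩
  -- basic estimates
  have hA : ∀ w v : ℝ × ℝ, |τ' w - τ' v| ≤ 2 * S * |w.1 - v.1| + η * Real.sqrt |w.2 - v.2| := by
    rintro ⟨y, t⟩ ⟨y₀, t₀⟩
    have h1 := hl t₀ y y₀
    have h2 := hh y t₀ t
    calc |τ' (y, t) - τ' (y₀, t₀)|
        = |(τ' (y, t₀) - τ' (y₀, t₀)) + (τ' (y, t) - τ' (y, t₀))| := by congr 1; ring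
      _ ≤ _ := abs_add_le _ _
      _ ≤ _ := add_le_add h1 h2
  have hD : ∀ w v : ℝ × ℝ, θ * |w.2 - v.2| ≤
        |τ w - τ v - τ' v * (w.1 - v.1)| + 2 * S * |w.1 - v.1| ^ 2 ∧
      |τ w - τ v - τ' v * (w.1 - v.1)| ≤ θ⁻¹ * |w.2 - v.2| + 2 * S * |w.1 - v.1| ^ 2 := by
    rintro ⟨y, t⟩ ⟨y₀, t₀⟩
    have h1 := taylor_aux (fun z => τ (z, t₀)) (fun z => τ' (z, t₀)) S hS
      (fun z => hd z t₀) (hl t₀) y₀ y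
    obtain ⟨h2, h3⟩ := hb y t₀ t
    dsimp only at *
    constructor
    · calc θ * |t - t₀| ≤ _ := h2
        _ = |(τ (y, t) - τ (y₀, t₀) - τ' (y₀, t₀) * (y - y₀)) -
            (τ (y, t₀) - τ (y₀, t₀) - τ' (y₀, t₀) * (y - y₀))| := by congr 1; ring
        _ ≤ _ := abs_sub _ _
        _ ≤ _ := by gcongr
    · calc _ = |(τ (y, t) - τ (y, t₀)) +
            (τ (y, t₀) - τ (y₀, t₀) - τ' (y₀, t₀) * (y - y₀))| := by congr 1; ring
        _ ≤ _ := abs_add_le _ _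
        _ ≤ _ := add_le_add h3 h1
  have hs : ∀ (w v : ℝ × ℝ) (M : ℝ), |w.1 - v.1| ≤ M →
      |τ w - τ v - τ' v * (w.1 - v.1)| ≤ M ^ 2 → Real.sqrt |w.2 - v.2| ≤ K * M := by
    intro w v M h1 h2
    have hM : 0 ≤ M := (abs_nonneg _).trans h1
    apply sqrt_le_of (by positivity) hM
    have h3 := (hD w v).1
    have h4 : |w.1 - v.1| ^ 2 ≤ M ^ 2 := by gcongr
    have h5 : θ * |w.2 - v.2| ≤ (1 + 2 * S) * M ^ 2 := by nlinarith
    rw [div_mul_eq_mul_div, le_div_iff₀ hθ]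
    linarith
  simp only [hmul]
  refine ⟨⟨⟨?_, ?_, ?_⟩, ?_⟩, ?_⟩
  · rintro p -
    simp [Piproj, Wsub]
  · rintro _ ⟨⟨y, t⟩, rfl⟩ _ ⟨⟨y₀, t₀⟩, rfl⟩ h
    simp only [Piproj, Prod.mk.injEq, true_and] at h
    obtain ⟨rfl, h⟩ := h
    have h' : τ (y, t) = τ (y, t₀) := by linarith
    have h1 := (hb y t₀ t).1
    rw [h', sub_self, abs_zero] at h1
    have h2 : |t - t₀| ≤ 0 := by
      by_contra hn
      push Not at hn
      have := mul_pos hθ hn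
      linarith
    have h3 : t = t₀ := by
      have := abs_nonpos_iff.1 h2
      linarith
    rw [h3]
  · rintro ⟨x, y, s⟩ hx
    have hx : x = 0 := hx
    subst hx
    obtain ⟨t, ht⟩ := surj_aux (fun t => τ (y, t)) θ hθ (hb y) s
    refine ⟨_, ⟨(y, t), rfl⟩, ?_⟩
    simp only [Piproj, Prod.mk.injEq, true_and]
    rw [ht]; ring
  · rintro _ ⟨w, rfl⟩ _ ⟨v, rfl⟩
    rw [hproj, hprod, Hnorm_proj]
    have e : Hnorm (PiL (τ' w - τ' v, w.1 - v.1,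
        (τ w - τ v - τ' v * (w.1 - v.1)) - (τ' w - τ' v) * (w.1 - v.1) / 2))
        = |τ' w - τ' v| := by
      simp [Hnorm, PiL, Real.sqrt_sq_eq_abs]
    rw [e]
    set M := max |w.1 - v.1| (Real.sqrt |τ w - τ v - τ' v * (w.1 - v.1)|) with hM
    have h1 : |w.1 - v.1| ≤ M := le_max_left _ _
    have hM0 : 0 ≤ M := (abs_nonneg _).trans h1
    have h2 : |τ w - τ v - τ' v * (w.1 - v.1)| ≤ M ^ 2 :=
      (Real.sqrt_le_left hM0).1 (le_max_right _ _)
    have h3 := hs w v M h1 h2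
    calc _ ≤ _ := hA w v
      _ ≤ 2 * S * M + η * (K * M) := by gcongr
      _ ≤ _ := by nlinarith
  · intro w v
    have hC0 : 0 < C := by positivity
    simp only [dH]
    rw [hprod]
    set A := τ' w - τ' v with hAdef
    set h := w.1 - v.1 with hhdef
    set D := τ w - τ v - τ' v * h with hDdef
    constructor
    · rw [inv_mul_le_iff₀ hC0]
      set N := Hnorm (A, h, D - A * h / 2) with hN
      have hx1 : |A| ≤ N := by
        refine le_trans ?_ (le_max_left _ _)
        exact Real.abs_le_sqrt (by simp only; nlinarith [sq_nonneg h])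
      have hx2 : |h| ≤ N := by
        refine le_trans ?_ (le_max_left _ _)
        exact Real.abs_le_sqrt (by simp only; nlinarith [sq_nonneg A])
      have hN0 : 0 ≤ N := (abs_nonneg _).trans hx1
      have hx3 : |D - A * h / 2| ≤ N ^ 2 := (Real.sqrt_le_left hN0).1 (le_max_right _ _)
      have hAh : |A * h| ≤ N * N := by rw [abs_mul]; gcongr
      have hx4 : |D| ≤ (2 * N) ^ 2 := by
        rw [abs_le] at *
        constructor <;> nlinarith
      have hx5 := hs w v (2 * N) (by linarith) hx4
      have hKN := mul_nonneg hK0 hN0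
      have hCN : (2 * (1 + K)) * N ≤ C * N := by
        apply mul_le_mul_of_nonneg_right _ hN0
        rw [hC]; linarith
      exact max_le (by nlinarith) (by nlinarith)
    · set d := dPar w v with hd'
      have h1 : |h| ≤ d := le_max_left _ _
      have h2 : Real.sqrt |w.2 - v.2| ≤ d := le_max_right _ _
      have hd0 : 0 ≤ d := (abs_nonneg _).trans h1
      have h3 : |w.2 - v.2| ≤ d ^ 2 := (Real.sqrt_le_left hd0).1 h2
      have h4 : |A| ≤ (2 * S + η) * d := by
        calc _ ≤ _ := hA w v
          _ ≤ 2 * S * d + η * d := by gcongr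
          _ = _ := by ring
      have h5 : |D| ≤ (θ⁻¹ + 2 * S) * d ^ 2 := by
        calc _ ≤ _ := (hD w v).2
          _ ≤ θ⁻¹ * d ^ 2 + 2 * S * d ^ 2 := by gcongr
          _ = _ := by ring
      have h6 : |A * h| ≤ ((2 * S + η) * d) * d := by rw [abs_mul]; gcongr
      have h7 : |D - A * h / 2| ≤ (θ⁻¹ + 2 * S + (S + η / 2)) * d ^ 2 := by
        rw [abs_le] at *
        constructor <;> nlinarith
      have h8 := sqrt_le_of (by positivity) hd0 h7
      have hKd := mul_nonneg hK0 hd0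
      have hCd := mul_nonneg hC₁0 hd0
      have hηd := mul_nonneg hη.le hd0
      have hSd := mul_nonneg hS.le hd0
      have hCe : C * d = 2 * d + 2 * (K * d) + (1 + 2 * S + η) * d + C₁ * d := by rw [hC]; ring
      apply max_le
      · refine (sqrt_sq_add_le _ _).trans ?_
        simp only
        rw [hCe]
        linarith
      · refine h8.trans ?_
        rw [hCe]
        nlinarith

end HeisRug
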